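/- The smooth maximum and smooth minimum are jointly continuous: the functions (a,b,γ) ↦ max_γ(a,b) and (a,b,γ) ↦ min_γ(a,b) are continuous on ℝ × ℝ × ℝ (in particular they are continuous across γ = 0, where they agree with max(a,b) and min(a,b) respectively). -/

import Mathlib

/-- Smooth maximum: `max γ a b`. -/
noncomputable def smax (γ a b : ℝ) : ℝ :=
  if γ ≤ 0 then max a b else γ * Real.log (Real.exp (a / γ) + Real.exp (b / γ))

/-- Smooth minimum: `min γ a b`. -/
noncomputable def smin (γ a b : ℝ) : ℝ :=
  if γ ≤ 0 then min a b else -γ * Real.log (Real.exp (-a / γ) + Real.exp (-b / γ))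

/-- Smooth Gaussian: `Gaussian γ a`. -/
noncomputable def sgauss (γ a : ℝ) : ℝ :=
  if γ ≤ 0 then (if a = 0 then 1 else 0) else Real.exp (-(a ^ 2) / (2 * γ ^ 2))

theorem abs_smax_sub_max_le (γ a b : ℝ) : |smax γ a b - max a b| ≤ max γ 0 * Real.log 2 := by
  rcases le_or_gt γ 0 with hγ | hγ
  · simp [smax, hγ]
  wlog hab : b ≤ a generalizing a b
  · simpa [smax, add_comm, max_comm] using this b a (le_of_not_ge hab)
  rw [smax, if_neg hγ.not_ge, max_eq_left hab, max_eq_left hγ.le]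
  have hexp : Real.exp (b / γ) ≤ Real.exp (a / γ) := by gcongr
  have hlower : a / γ ≤ Real.log (Real.exp (a / γ) + Real.exp (b / γ)) := by
    rw [Real.le_log_iff_exp_le (by positivity)]
    exact le_add_of_nonneg_right (Real.exp_pos _).le
  have hupper : Real.log (Real.exp (a / γ) + Real.exp (b / γ)) ≤ Real.log 2 + a / γ := by
    rw [Real.log_le_iff_le_exp (by positivity), Real.exp_add, Real.exp_log two_pos]
    linarith
  have hscale : γ * (a / γ) = a := mul_div_cancel₀ a hγ.ne'
  rw [abs_of_nonneg] <;>
    nlinarith [mul_le_mul_of_nonneg_left hlower hγ.le, mul_le_mul_of_nonneg_left hupper hγ.le]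

open Filter Topology in
theorem continuous_smax : Continuous (fun p : ℝ × ℝ × ℝ => smax p.2.2 p.1 p.2.1) := by
  rw [continuous_iff_continuousAt]
  rintro ⟨a, b, γ⟩
  rcases le_or_gt γ 0 with hγ | hγ
  · have hbound : Tendsto (fun p : ℝ × ℝ × ℝ => max p.2.2 0 * Real.log 2) (𝓝 (a, b, γ)) (𝓝 0) := by
      have hcont : Continuous (fun p : ℝ × ℝ × ℝ => max p.2.2 0 * Real.log 2) := by fun_prop
      simpa [hγ] using hcont.tendsto (a, b, γ)
    have hdiff : Tendsto (fun p : ℝ × ℝ × ℝ => smax p.2.2 p.1 p.2.1 - max p.1 p.2.1)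
        (𝓝 (a, b, γ)) (𝓝 0) :=
      squeeze_zero_norm (fun p => abs_smax_sub_max_le p.2.2 p.1 p.2.1) hbound
    have hmax : Continuous (fun p : ℝ × ℝ × ℝ => max p.1 p.2.1) := by fun_prop
    simpa [ContinuousAt, smax, hγ] using hdiff.add (hmax.tendsto (a, b, γ))
  · have hpos : ∀ᶠ p : ℝ × ℝ × ℝ in 𝓝 (a, b, γ), 0 < p.2.2 :=
      continuousAt_const.eventually_lt (by fun_prop) hγ
    have hformula : ContinuousAt (fun p : ℝ × ℝ × ℝ =>
        p.2.2 * Real.log (Real.exp (p.1 / p.2.2) + Real.exp (p.2.1 / p.2.2))) (a, b, γ) := by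
      have hne : γ ≠ 0 := hγ.ne'
      have hsum : Real.exp (a / γ) + Real.exp (b / γ) ≠ 0 := by positivity
      fun_prop (disch := assumption)
    refine hformula.congr ?_
    filter_upwards [hpos] with p hp
    simp [smax, hp.not_ge]

theorem smin_eq_neg_smax_neg (γ a b : ℝ) : smin γ a b = -smax γ (-a) (-b) := by
  unfold smin smax
  split_ifs
  · rw [max_neg_neg, neg_neg]
  · ring

/-- the smooth maximum and minimum are jointly continuous in
(a, b, γ). -/
theorem smax_smin_continuous :
    Continuous (fun p : ℝ × ℝ × ℝ => smax p.2.2 p.1 p.2.1) ∧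
      Continuous (fun p : ℝ × ℝ × ℝ => smin p.2.2 p.1 p.2.1) := by
  refine ⟨continuous_smax, ?_⟩
  simp only [smin_eq_neg_smax_neg]
  exact (continuous_smax.comp (g := fun p : ℝ × ℝ × ℝ => smax p.2.2 p.1 p.2.1)
    (f := fun p : ℝ × ℝ × ℝ => (-p.1, -p.2.1, p.2.2)) (by fun_prop)).neg
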